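/- There is an absolute constant K such that for every prime p and every finite subset A of 𝔽_p one has E₊(A) ≤ K·(|A·A|^(3/2)·|A| + |A·A|²·|A|²/p). -/

import Mathlib

open Finset Pointwise

/-- Additive energy `E₊(A) = #{(a₁,a₂,a₃,a₄) ∈ A⁴ : a₁+a₂ = a₃+a₄}` in `𝔽_p`. -/
def addE {p : ℕ} (A : Finset (ZMod p)) : ℕ :=
  ((A ×ˢ A ×ˢ A ×ˢ A).filter fun x => x.1 + x.2.1 = x.2.2.1 + x.2.2.2).card

namespace NullLine

open Polynomial

variable {K : Type*} [Field K]

/-- The point with parameter `t` on the null line `ℓ = (s, e, f)`. -/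
def point (ℓ : K × K × K) (t : K) : Fin 3 → K :=
  ![ℓ.1 ^ 2 * t + ℓ.2.1, ℓ.1 * t + ℓ.2.2, t]

/-- Two null lines `(s, e, f)` of different slopes `s` intersect exactly when they satisfy
this relation. -/
def Meets (ℓ m : K × K × K) : Prop :=
  (ℓ.1 + m.1) * (m.2.2 - ℓ.2.2) = m.2.1 - ℓ.2.1

/-- The parameter of the common point of two null lines that meet. -/
def param (ℓ m : K × K × K) : K := (m.2.2 - ℓ.2.2) / (ℓ.1 - m.1)

/-- Restriction of a polynomial to a null line. -/
noncomputable def restr (ℓ : K × K × K) : MvPolynomial (Fin 3) K →ₐ[K] K[X] :=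
  MvPolynomial.aeval ![C (ℓ.1 ^ 2) * X + C ℓ.2.1, C ℓ.1 * X + C ℓ.2.2, X]

theorem Meets.symm {ℓ m : K × K × K} (h : Meets ℓ m) : Meets m ℓ := by
  unfold Meets at *
  linear_combination -h

theorem point_param {ℓ m : K × K × K} (h : Meets ℓ m) (hs : ℓ.1 ≠ m.1) :
    point ℓ (param ℓ m) = point m (param ℓ m) := by
  have hs' : ℓ.1 - m.1 ≠ 0 := sub_ne_zero.2 hs
  have ht : param ℓ m * (ℓ.1 - m.1) = m.2.2 - ℓ.2.2 := div_mul_cancel₀ _ hs'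
  unfold Meets at h
  ext i
  fin_cases i
  · simp only [point, Fin.zero_eta, Matrix.cons_val_zero]
    linear_combination (ℓ.1 + m.1) * ht + h
  · simp only [point, Fin.mk_one, Matrix.cons_val_one, Matrix.cons_val_zero]
    linear_combination ht
  · simp [point]

theorem meets_of_point_eq {ℓ m : K × K × K} {t : K} (h : point ℓ t = point m t) :
    Meets ℓ m := by
  have h0 := congrFun h 0
  have h1 := congrFun h 1
  simp only [point, Matrix.cons_val_zero, Matrix.cons_val_one] at h0 h1
  unfold Meets
  linear_combination h0 - (ℓ.1 + m.1) * h1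

theorem eval_restr (ℓ : K × K × K) (t : K) (P : MvPolynomial (Fin 3) K) :
    (restr ℓ P).eval t = MvPolynomial.eval (point ℓ t) P := by
  induction P using MvPolynomial.induction_on with
  | C a => simp [restr]
  | add p q hp hq => simp [hp, hq]
  | mul_X p i hp =>
    rw [map_mul, map_mul, eval_mul, hp]
    congr 1
    fin_cases i <;> simp [restr, point]

theorem natDegree_restr_le (ℓ : K × K × K) (P : MvPolynomial (Fin 3) K) :
    (restr ℓ P).natDegree ≤ P.totalDegree := by
  have := MvPolynomial.aeval_natDegree_le (n := 1) P le_rfl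
    ![C (ℓ.1 ^ 2) * X + C ℓ.2.1, C ℓ.1 * X + C ℓ.2.2, X] (by
      intro i
      fin_cases i
      · exact natDegree_linear_le
      · exact natDegree_linear_le
      · exact natDegree_X_le)
  simpa [restr] using this

theorem derivative_restr (ℓ : K × K × K) (P : MvPolynomial (Fin 3) K) :
    derivative (restr ℓ P) = C (ℓ.1 ^ 2) * restr ℓ (MvPolynomial.pderiv 0 P) +
      C ℓ.1 * restr ℓ (MvPolynomial.pderiv 1 P) + restr ℓ (MvPolynomial.pderiv 2 P) := by
  induction P using MvPolynomial.induction_on with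
  | C a => simp [restr]
  | add p q hp hq => simp only [map_add, hp, hq]; ring
  | mul_X p i hp =>
    simp only [map_mul, derivative_mul, hp, Derivation.leibniz, smul_eq_mul, map_add,
      MvPolynomial.pderiv_X]
    fin_cases i <;> simp [restr, derivative_pow] <;> ring

theorem pderiv_comm {σ : Type*} (i j : σ) (P : MvPolynomial σ K) :
    MvPolynomial.pderiv i (MvPolynomial.pderiv j P) =
      MvPolynomial.pderiv j (MvPolynomial.pderiv i P) := by
  classical
  induction P using MvPolynomial.induction_on with
  | C a => simp
  | add p q hp hq => simp only [map_add, hp, hq]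
  | mul_X p k hp =>
    simp only [Derivation.leibniz, smul_eq_mul, map_add, hp, MvPolynomial.pderiv_X,
      Pi.single_apply]
    split_ifs <;> simp <;> ring

theorem totalDegree_pderiv_le {σ : Type*} (i : σ) (P : MvPolynomial σ K) :
    (MvPolynomial.pderiv i P).totalDegree ≤ P.totalDegree - 1 := by
  classical
  rw [MvPolynomial.totalDegree, Finset.sup_le_iff]
  intro m hm
  rw [MvPolynomial.mem_support_iff, MvPolynomial.coeff_pderiv] at hm
  have h := MvPolynomial.le_totalDegree (MvPolynomial.mem_support_iff.2 (left_ne_zero_of_mul hm))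
  rw [Finsupp.sum_add_index' (by simp) (by simp)] at h
  simp only [Finsupp.sum_single_index] at h
  omega

theorem exists_pderiv_ne_zero {σ : Type*} (p : ℕ) [CharP K p] {P : MvPolynomial σ K}
    (h0 : P.totalDegree ≠ 0) (hp : P.totalDegree < p) :
    ∃ i, MvPolynomial.pderiv i P ≠ 0 := by
  classical
  by_contra! h
  apply h0
  rw [MvPolynomial.totalDegree_eq_zero_iff]
  intro m hm i
  by_contra hi
  have h1 := congrArg (MvPolynomial.coeff (m - Finsupp.single i 1)) (h i)
  have h2 : m - Finsupp.single i 1 + Finsupp.single i 1 = m :=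
    Finsupp.sub_add_single_one_cancel hi
  rw [MvPolynomial.coeff_pderiv, h2, MvPolynomial.coeff_zero, mul_eq_zero] at h1
  rcases h1 with h1 | h1
  · exact MvPolynomial.mem_support_iff.1 hm h1
  · have h3 : ((m i : ℕ) : K) = 0 := by
      rw [← h1]
      have : (m - Finsupp.single i 1 : σ →₀ ℕ) i + 1 = m i := by
        have := DFunLike.congr_fun h2 i
        simpa using this
      rw [← this]; push_cast; rfl
    rw [CharP.cast_eq_zero_iff K p] at h3
    have h4 := Nat.le_of_dvd (Nat.pos_of_ne_zero hi) h3
    have h5 := MvPolynomial.le_totalDegree hm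
    have h6 : m i ≤ m.sum fun _ e => e :=
      Finset.single_le_sum (f := fun j => m j) (fun _ _ => Nat.zero_le _)
        (Finsupp.mem_support_iff.2 hi)
    omega

/-- Two polynomials of small degree with vanishing Wronskian are proportional. -/
theorem exists_eq_C_mul_of_wronskian (p : ℕ) [CharP K p] {N M : K[X]} (hM : M ≠ 0)
    (hN' : N.natDegree < p) (hM' : M.natDegree < p)
    (h : derivative N * M = N * derivative M) : ∃ c, N = C c * M := by
  have key : ∀ N : K[X], N ≠ 0 → N.natDegree < p → derivative N * M = N * derivative M →
      N.natDegree = M.natDegree := by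
    intro N hN hN' h
    have hX : ∀ Q : K[X], (X * derivative Q).natDegree ≤ Q.natDegree ∧
        (X * derivative Q).coeff Q.natDegree = Q.natDegree * Q.leadingCoeff := by
      intro Q
      rcases Nat.eq_zero_or_pos Q.natDegree with h0 | h0
      · rw [eq_C_of_natDegree_eq_zero h0]; simp
      · refine ⟨?_, ?_⟩
        · refine natDegree_mul_le.trans ?_
          have := natDegree_derivative_lt h0.ne'
          rw [natDegree_X]; omega
        · obtain ⟨n, hn⟩ := Nat.exists_eq_succ_of_ne_zero h0.ne'
          rw [leadingCoeff, hn, Nat.succ_eq_add_one, coeff_X_mul, coeff_derivative]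
          push_cast; ring
    have h1 : (X * derivative N) * M = N * (X * derivative M) := by
      linear_combination X * h
    have h2 := congrArg (fun Q => Q.coeff (N.natDegree + M.natDegree)) h1
    beta_reduce at h2
    rw [coeff_mul_add_eq_of_natDegree_le (hX N).1 le_rfl,
      coeff_mul_add_eq_of_natDegree_le le_rfl (hX M).1,
      (hX N).2, (hX M).2, coeff_natDegree, coeff_natDegree] at h2
    have h3 : ((N.natDegree : ℕ) : K) = (M.natDegree : ℕ) := by
      have a := leadingCoeff_ne_zero.2 hN
      have b := leadingCoeff_ne_zero.2 hM
      apply mul_right_cancel₀ (mul_ne_zero a b)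
      linear_combination h2
    rw [CharP.natCast_eq_natCast K p] at h3
    rwa [Nat.ModEq, Nat.mod_eq_of_lt hN', Nat.mod_eq_of_lt hM'] at h3
  by_cases hN : N = 0
  · exact ⟨0, by simp [hN]⟩
  refine ⟨N.leadingCoeff / M.leadingCoeff, ?_⟩
  set c := N.leadingCoeff / M.leadingCoeff with hc
  have hb := leadingCoeff_ne_zero.2 hM
  have hdeg := key N hN hN' h
  by_contra hne
  have hne' : N - C c * M ≠ 0 := sub_ne_zero.2 hne
  have hle : (N - C c * M).natDegree ≤ M.natDegree :=
    (natDegree_sub_le _ _).trans (max_le hdeg.le (natDegree_C_mul_le _ _))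
  have h1 := key _ hne' (hle.trans_lt hM') (by
    simp only [derivative_sub, derivative_C_mul]
    linear_combination h)
  have h2 : (N - C c * M).coeff M.natDegree = 0 := by
    rw [coeff_sub, coeff_C_mul, coeff_natDegree, ← hdeg, coeff_natDegree, hc,
      div_mul_cancel₀ _ hb, sub_self]
  rw [← h1, coeff_natDegree, leadingCoeff_eq_zero] at h2
  exact hne' h2

/-- If the second derivative of `a / b` vanishes and the degrees are small, then
`a / b` is a polynomial of degree at most one. -/
theorem exists_linear_of_second_derivative (p : ℕ) [CharP K p] {a b : K[X]} {D : ℕ}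
    (hb : b ≠ 0) (haD : a.natDegree ≤ D) (hbD : b.natDegree ≤ D) (hD : 2 * D + 1 < p)
    (h : (derivative (derivative a) * b - a * derivative (derivative b)) * b -
      2 * derivative b * (derivative a * b - a * derivative b) = 0) :
    ∃ α κ : K, a = (C α + C κ * X) * b := by
  have hda := natDegree_derivative_le a
  have hdb := natDegree_derivative_le b
  obtain ⟨κ, hκ⟩ := exists_eq_C_mul_of_wronskian p (N := derivative a * b - a * derivative b)
    (M := b ^ 2) (pow_ne_zero 2 hb) (by
      refine lt_of_le_of_lt (natDegree_sub_le _ _) (max_lt ?_ ?_)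
      · exact natDegree_mul_le.trans_lt (by omega)
      · exact natDegree_mul_le.trans_lt (by omega)) (by
      refine lt_of_le_of_lt natDegree_pow_le ?_
      omega) (by
      simp only [derivative_sub, derivative_mul, derivative_pow, Nat.cast_ofNat, map_ofNat,
        Nat.add_one_sub_one, pow_one]
      linear_combination b * h)
  obtain ⟨α, hα⟩ := exists_eq_C_mul_of_wronskian p (N := a - C κ * X * b) (M := b) hb (by
      refine lt_of_le_of_lt (natDegree_sub_le _ _) (max_lt (by omega) ?_)
      have := (natDegree_C_mul_le κ X).trans natDegree_X_le
      exact natDegree_mul_le.trans_lt (by omega)) (by omega) (by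
      simp only [derivative_sub, derivative_mul, derivative_C, derivative_X]
      linear_combination hκ)
  exact ⟨α, κ, by linear_combination hα⟩

theorem second_derivative_identity {s₀ s U V W uu uv uw vv vw ww : K}
    {uuu uuv uuw uvv uvw uww vvv vvw vww www : K} (hs : s ≠ s₀) (hU : U ≠ 0)
    (h1 : s ^ 2 * U + s * V + W = 0) (h2 : s₀ ^ 2 * U + s₀ * V + W = 0)
    (h3 : s ^ 4 * uu + 2 * s ^ 3 * uv + s ^ 2 * (2 * uw + vv) + 2 * s * vw + ww = 0)
    (h4 : s₀ ^ 4 * uu + 2 * s₀ ^ 3 * uv + s₀ ^ 2 * (2 * uw + vv) + 2 * s₀ * vw + ww = 0)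
    (h6 : s₀ ^ 6 * uuu + 3 * s₀ ^ 5 * uuv + 3 * s₀ ^ 4 * (uuw + uvv)
      + s₀ ^ 3 * (6 * uvw + vvv) + 3 * s₀ ^ 2 * (uww + vvw) + 3 * s₀ * vww + www = 0)
    {N N' U' T : K} (hN : N = s₀ * U)
    (hU' : U' = s ^ 2 * uu + s * uv + uw)
    (hN' : N' = -((s ^ 2 * uv + s * vv + vw) + s * U'))
    (hT : T = s₀ ^ 4 * (s ^ 2 * uuu + s * uuv + uuw)
      + 2 * s₀ ^ 3 * (s ^ 2 * uuv + s * uvv + uvw)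
      + s₀ ^ 2 * (2 * (s ^ 2 * uuw + s * uvw + uww) + (s ^ 2 * uvv + s * vvv + vvw))
      + 2 * s₀ * (s ^ 2 * uvw + s * vvw + vww) + (s ^ 2 * uww + s * vww + www))
    (h5 : U ^ 4 * T + N' * (4 * N ^ 3 * uu + 6 * N ^ 2 * U * uv
        + 2 * N * U ^ 2 * (2 * uw + vv) + 2 * U ^ 3 * vw)
      + U' * (2 * N ^ 3 * uv + 2 * N ^ 2 * U * (2 * uw + vv) + 6 * N * U ^ 2 * vw
        + 4 * U ^ 3 * ww) = 0)
    {a' a'' b b' b'' : K}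
    (hb : b = -(V + 2 * s₀ * U))
    (ha' : a' = s₀ ^ 2 * uu + s₀ * uv + uw)
    (hb' : b' = -((s₀ ^ 2 * uv + s₀ * vv + vw) + 2 * s₀ * a'))
    (ha'' : a'' = s₀ ^ 4 * uuu + 2 * s₀ ^ 3 * uuv + s₀ ^ 2 * (2 * uuw + uvv)
      + 2 * s₀ * uvw + uww)
    (hb'' : b'' = -((s₀ ^ 4 * uuv + 2 * s₀ ^ 3 * uvv + s₀ ^ 2 * (2 * uvw + vvv)
      + 2 * s₀ * vvw + vww) + 2 * s₀ * a'')) :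
    (a'' * b - U * b'') * b - 2 * b' * (a' * b - U * b') = 0 := by
  have hΔ : s - s₀ ≠ 0 := sub_ne_zero.2 hs
  have hV : V = -(s + s₀) * U := by
    apply mul_left_cancel₀ hΔ
    linear_combination h1 - h2
  have hbΔ : b = (s - s₀) * U := by rw [hb, hV]; ring
  have hT' : T = (s - s₀) ^ 2 * a'' - (s - s₀) * b'' := by
    rw [hT, hb'', ha'']
    linear_combination h6
  have hM : N' - s₀ * U' = -(b' * (-1) * (-1) - (s - s₀) * a') := by
    apply mul_left_cancel₀ hΔ
    rw [hN', hU', hb', ha']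
    linear_combination -h3 + h4
  have h7 : U ^ 3 * (U * T + 2 * b' * (b' - (s - s₀) * a')) = 0 := by
    rw [hN] at h5
    have e : N' = s₀ * U' - (b' - (s - s₀) * a') := by linear_combination hM
    rw [e] at h5
    have e2 : -2 * b' = 4 * s₀ ^ 3 * uu + 6 * s₀ ^ 2 * uv + 2 * s₀ * (2 * uw + vv)
        + 2 * vw := by
      rw [hb', ha']; ring
    linear_combination h5 - 4 * U ^ 3 * U' * h4 - U ^ 3 * (b' - (s - s₀) * a') * e2
  have h8 := (mul_eq_zero.1 h7).resolve_left (pow_ne_zero 3 hU)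
  rw [hbΔ]
  rw [hT'] at h8
  linear_combination U * h8

theorem first_order {ℓ : K × K × K} {P : MvPolynomial (Fin 3) K} (h : restr ℓ P = 0) :
    C (ℓ.1 ^ 2) * restr ℓ (MvPolynomial.pderiv 0 P) +
      C ℓ.1 * restr ℓ (MvPolynomial.pderiv 1 P) + restr ℓ (MvPolynomial.pderiv 2 P) = 0 := by
  rw [← derivative_restr, h, derivative_zero]

/-- Up to a constant, the value of the Hessian of `P` at the null direction other than that
of `m` which is tangent to the surface `P = 0`, along the line `m`. -/
noncomputable def otherHessian (m : K × K × K) (P : MvPolynomial (Fin 3) K) : K[X] :=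
  let U := restr m (MvPolynomial.pderiv 0 P)
  let N := -(restr m (MvPolynomial.pderiv 1 P) + C m.1 * U)
  N ^ 4 * restr m (MvPolynomial.pderiv 0 (MvPolynomial.pderiv 0 P))
    + 2 * N ^ 3 * U * restr m (MvPolynomial.pderiv 0 (MvPolynomial.pderiv 1 P))
    + N ^ 2 * U ^ 2 * (2 * restr m (MvPolynomial.pderiv 0 (MvPolynomial.pderiv 2 P))
      + restr m (MvPolynomial.pderiv 1 (MvPolynomial.pderiv 1 P)))
    + 2 * N * U ^ 3 * restr m (MvPolynomial.pderiv 1 (MvPolynomial.pderiv 2 P))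
    + U ^ 4 * restr m (MvPolynomial.pderiv 2 (MvPolynomial.pderiv 2 P))

theorem natDegree_otherHessian_le (m : K × K × K) (P : MvPolynomial (Fin 3) K) :
    (otherHessian m P).natDegree ≤ 5 * P.totalDegree := by
  have h1 : ∀ i, (restr m (MvPolynomial.pderiv i P)).natDegree ≤ P.totalDegree := fun i =>
    (natDegree_restr_le _ _).trans ((totalDegree_pderiv_le i P).trans (Nat.sub_le _ _))
  have h2 : ∀ i j, (restr m (MvPolynomial.pderiv i (MvPolynomial.pderiv j P))).natDegree ≤
      P.totalDegree := fun i j =>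
    (natDegree_restr_le _ _).trans ((totalDegree_pderiv_le i _).trans ((Nat.sub_le _ _).trans
      ((totalDegree_pderiv_le j P).trans (Nat.sub_le _ _))))
  have hN : (-(restr m (MvPolynomial.pderiv 1 P) +
      C m.1 * restr m (MvPolynomial.pderiv 0 P))).natDegree ≤ P.totalDegree := by
    rw [natDegree_neg]
    exact natDegree_add_le_of_degree_le (h1 1) ((natDegree_C_mul_le _ _).trans (h1 0))
  have h2' : ((2 : K[X])).natDegree ≤ 0 := (natDegree_ofNat 2).le
  unfold otherHessian
  refine natDegree_add_le_of_degree_le (natDegree_add_le_of_degree_le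
    (natDegree_add_le_of_degree_le (natDegree_add_le_of_degree_le ?_ ?_) ?_) ?_) ?_
  · exact (natDegree_mul_le_of_le (natDegree_pow_le_of_le 4 hN) (h2 0 0)).trans (by omega)
  · exact (natDegree_mul_le_of_le (natDegree_mul_le_of_le (natDegree_mul_le_of_le h2'
      (natDegree_pow_le_of_le 3 hN)) (h1 0)) (h2 0 1)).trans (by omega)
  · exact (natDegree_mul_le_of_le (natDegree_mul_le_of_le (natDegree_pow_le_of_le 2 hN)
      (natDegree_pow_le_of_le 2 (h1 0))) (natDegree_add_le_of_degree_le
      ((natDegree_mul_le_of_le h2' (h2 0 2)).trans (zero_add _).le) (h2 1 1))).trans (by omega)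
  · exact (natDegree_mul_le_of_le (natDegree_mul_le_of_le (natDegree_mul_le_of_le h2' hN)
      (natDegree_pow_le_of_le 3 (h1 0))) (h2 1 2)).trans (by omega)
  · exact (natDegree_mul_le_of_le (natDegree_pow_le_of_le 4 (h1 0)) (h2 2 2)).trans (by omega)

theorem eq_zero_of_eval_param {m : K × K × K} {L : Finset (K × K × K)} {Q : K[X]}
    (hm : ∀ n ∈ L, Meets m n ∧ m.1 ≠ n.1)
    (hL : ∀ n ∈ L, ∀ n' ∈ L, Meets n n' → n = n')
    (hQ : ∀ n ∈ L, Q.eval (param m n) = 0) (hcard : Q.natDegree < #L) : Q = 0 := by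
  classical
  refine eq_zero_of_natDegree_lt_card_of_eval_eq_zero' Q (L.image (param m)) ?_ ?_
  · intro x hx
    obtain ⟨n, hn, rfl⟩ := mem_image.1 hx
    exact hQ n hn
  · rwa [card_image_of_injOn]
    intro n hn n' hn' h
    apply hL n hn n' hn'
    apply meets_of_point_eq (t := param m n)
    rw [← point_param (hm n hn).1 (hm n hn).2]
    rw [h, ← point_param (hm n' hn').1 (hm n' hn').2]

theorem eval_restr_param {ℓ m : K × K × K} (h : Meets ℓ m) (hs : ℓ.1 ≠ m.1)
    (Q : MvPolynomial (Fin 3) K) :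
    (restr m Q).eval (param ℓ m) = (restr ℓ Q).eval (param ℓ m) := by
  rw [eval_restr, eval_restr, point_param h hs]

theorem hessian_eq_zero {ℓ : K × K × K} {P : MvPolynomial (Fin 3) K} (h : restr ℓ P = 0) :
    C ℓ.1 ^ 4 * restr ℓ (MvPolynomial.pderiv 0 (MvPolynomial.pderiv 0 P))
    + 2 * C ℓ.1 ^ 3 * restr ℓ (MvPolynomial.pderiv 0 (MvPolynomial.pderiv 1 P))
    + C ℓ.1 ^ 2 * (2 * restr ℓ (MvPolynomial.pderiv 0 (MvPolynomial.pderiv 2 P))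
      + restr ℓ (MvPolynomial.pderiv 1 (MvPolynomial.pderiv 1 P)))
    + 2 * C ℓ.1 * restr ℓ (MvPolynomial.pderiv 1 (MvPolynomial.pderiv 2 P))
    + restr ℓ (MvPolynomial.pderiv 2 (MvPolynomial.pderiv 2 P)) = 0 := by
  have h1 := congrArg derivative (first_order h)
  simp only [map_add, derivative_mul, derivative_C, derivative_zero, derivative_pow,
    derivative_restr, C_pow] at h1
  simp only [pderiv_comm (1 : Fin 3) 0, pderiv_comm (2 : Fin 3) 0, pderiv_comm (2 : Fin 3) 1] at h1
  linear_combination h1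

theorem otherHessian_eq_zero {m : K × K × K} {L : Finset (K × K × K)}
    {P : MvPolynomial (Fin 3) K}
    (hm : ∀ n ∈ L, Meets m n ∧ m.1 ≠ n.1)
    (hL : ∀ n ∈ L, ∀ n' ∈ L, Meets n n' → n = n')
    (hPm : restr m P = 0) (hPL : ∀ n ∈ L, restr n P = 0)
    (hcard : 5 * P.totalDegree < #L) : otherHessian m P = 0 := by
  refine eq_zero_of_eval_param hm hL ?_ ((natDegree_otherHessian_le m P).trans_lt hcard)
  intro n hn
  obtain ⟨hmn, hs⟩ := hm n hn
  have h1 := congrArg (eval (param m n)) (first_order hPm)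
  have h2 := congrArg (eval (param m n)) (first_order (hPL n hn))
  have h3 := congrArg (eval (param m n)) (hessian_eq_zero (hPL n hn))
  simp only [eval_add, eval_mul, eval_C, eval_zero, eval_pow, eval_ofNat,
    eval_restr_param hmn hs] at h1 h2 h3
  simp only [otherHessian, eval_add, eval_mul, eval_C, eval_pow, eval_ofNat,
    eval_neg]
  generalize eval (param m n) (restr m (MvPolynomial.pderiv 0 P)) = U at *
  generalize eval (param m n) (restr m (MvPolynomial.pderiv 1 P)) = V at *
  have hV : -(V + m.1 * U) = n.1 * U := by
    apply mul_left_cancel₀ (sub_ne_zero.2 hs)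
    linear_combination -h1 + h2
  rw [hV]
  linear_combination U ^ 4 * h3

theorem third_order {ℓ : K × K × K} {P : MvPolynomial (Fin 3) K} (h : restr ℓ P = 0) :
    C ℓ.1 ^ 6 * restr ℓ (MvPolynomial.pderiv 0 (MvPolynomial.pderiv 0 (MvPolynomial.pderiv 0 P)))
    + 3 * C ℓ.1 ^ 5 *
      restr ℓ (MvPolynomial.pderiv 0 (MvPolynomial.pderiv 0 (MvPolynomial.pderiv 1 P)))
    + 3 * C ℓ.1 ^ 4 *
      (restr ℓ (MvPolynomial.pderiv 0 (MvPolynomial.pderiv 0 (MvPolynomial.pderiv 2 P)))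
      + restr ℓ (MvPolynomial.pderiv 0 (MvPolynomial.pderiv 1 (MvPolynomial.pderiv 1 P))))
    + C ℓ.1 ^ 3 *
      (6 * restr ℓ (MvPolynomial.pderiv 0 (MvPolynomial.pderiv 1 (MvPolynomial.pderiv 2 P)))
      + restr ℓ (MvPolynomial.pderiv 1 (MvPolynomial.pderiv 1 (MvPolynomial.pderiv 1 P))))
    + 3 * C ℓ.1 ^ 2 *
      (restr ℓ (MvPolynomial.pderiv 0 (MvPolynomial.pderiv 2 (MvPolynomial.pderiv 2 P)))
      + restr ℓ (MvPolynomial.pderiv 1 (MvPolynomial.pderiv 1 (MvPolynomial.pderiv 2 P))))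
    + 3 * C ℓ.1 * restr ℓ (MvPolynomial.pderiv 1 (MvPolynomial.pderiv 2 (MvPolynomial.pderiv 2 P)))
    + restr ℓ (MvPolynomial.pderiv 2 (MvPolynomial.pderiv 2 (MvPolynomial.pderiv 2 P))) = 0 := by
  have h1 := congrArg derivative (hessian_eq_zero h)
  simp only [map_add, derivative_mul, derivative_C, derivative_zero, derivative_pow,
    derivative_ofNat, derivative_restr, C_pow] at h1
  simp only [pderiv_comm (1 : Fin 3) 0, pderiv_comm (2 : Fin 3) 0, pderiv_comm (2 : Fin 3) 1] at h1
  linear_combination h1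

/-- At the point where `ℓ` meets `m`, the second derivative along `ℓ` of the quotient describing
the tangent planes of the surface `P = 0` vanishes. -/
theorem eval_second_derivative_eq_zero {ℓ m : K × K × K} {P : MvPolynomial (Fin 3) K}
    (hℓm : Meets ℓ m) (hs : ℓ.1 ≠ m.1) (hPℓ : restr ℓ P = 0) (hPm : restr m P = 0)
    (hH : otherHessian m P = 0) {a b : K[X]} (ha : a = restr ℓ (MvPolynomial.pderiv 0 P))
    (hb : b = -(restr ℓ (MvPolynomial.pderiv 1 P) + C (2 * ℓ.1) * a)) :
    ((derivative (derivative a) * b - a * derivative (derivative b)) * b -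
      2 * derivative b * (derivative a * b - a * derivative b)).eval (param ℓ m) = 0 := by
  have h1 := congrArg (eval (param ℓ m)) (first_order hPm)
  have h2 := congrArg (eval (param ℓ m)) (first_order hPℓ)
  have h3 := congrArg (eval (param ℓ m)) (hessian_eq_zero hPm)
  have h4 := congrArg (eval (param ℓ m)) (hessian_eq_zero hPℓ)
  have h6 := congrArg (eval (param ℓ m)) (third_order hPℓ)
  have h5 := congrArg (fun Q => eval (param ℓ m) (derivative Q)) hH
  simp only [eval_add, eval_mul, eval_C, eval_zero, eval_pow, eval_ofNat,
    eval_restr_param hℓm hs] at h1 h2 h3 h4 h6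
  simp only [otherHessian, derivative_add, derivative_mul, derivative_neg, derivative_C,
    derivative_zero, derivative_pow, derivative_ofNat, derivative_restr, pderiv_comm (1 : Fin 3) 0,
    pderiv_comm (2 : Fin 3) 0, pderiv_comm (2 : Fin 3) 1, eval_add, eval_mul, eval_C,
    eval_zero, eval_pow, eval_ofNat, eval_neg, eval_restr_param hℓm hs, C_pow,
    Nat.cast_ofNat, map_ofNat] at h5
  rw [hb, ha]
  simp only [derivative_add, derivative_mul, derivative_neg, derivative_C,
    derivative_zero, derivative_pow, derivative_ofNat, derivative_restr, pderiv_comm (1 : Fin 3) 0,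
    pderiv_comm (2 : Fin 3) 0, pderiv_comm (2 : Fin 3) 1, eval_add, eval_mul, eval_C,
    eval_zero, eval_pow, eval_ofNat, eval_neg, eval_sub, C_pow, C_mul, map_ofNat]
  generalize eval (param ℓ m) (restr ℓ (MvPolynomial.pderiv 0 P)) = U at *
  generalize eval (param ℓ m) (restr ℓ (MvPolynomial.pderiv 1 P)) = V at *
  have hV : -(V + m.1 * U) = ℓ.1 * U := by
    apply mul_left_cancel₀ (sub_ne_zero.2 hs)
    linear_combination h1 - h2
  by_cases hU : U = 0
  · have hV0 : V = 0 := by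
      rw [hU] at hV
      linear_combination -hV
    rw [hU, hV0]
    ring
  · rw [hV] at h5
    have := second_derivative_identity hs.symm hU h1 h2 h3 h4 h6 rfl rfl rfl rfl
      (by linear_combination h5) rfl rfl rfl rfl rfl
    linear_combination this

open scoped Classical in
/-- At a line `ℓ` where some first derivative of `P` does not vanish, most of the lines that meet
`ℓ` satisfy a common linear equation. -/
theorem exists_linear_relation (p : ℕ) [CharP K p] {ℓ : K × K × K} {L : Finset (K × K × K)}
    {P : MvPolynomial (Fin 3) K} {D : ℕ} (hℓ : ∀ m ∈ L, Meets ℓ m ∧ ℓ.1 ≠ m.1)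
    (hL : ∀ m ∈ L, ∀ m' ∈ L, Meets m m' → m = m') (hPℓ : restr ℓ P = 0)
    (hPL : ∀ m ∈ L, restr m P = 0) (hH : ∀ m ∈ L, otherHessian m P = 0)
    (hPD : P.totalDegree ≤ D) (hD : 2 * D + 1 < p) (hcard : 3 * D < #L)
    (hgrad : ∃ i, restr ℓ (MvPolynomial.pderiv i P) ≠ 0) :
    ∃ A B c : K, (A ≠ 0 ∨ B ≠ 0) ∧ #L ≤ D + #{m ∈ L | A * m.1 + B * m.2.2 = c} := by
  set a := restr ℓ (MvPolynomial.pderiv 0 P) with ha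
  set b := -(restr ℓ (MvPolynomial.pderiv 1 P) + C (2 * ℓ.1) * a) with hb
  have hdeg : ∀ i, (restr ℓ (MvPolynomial.pderiv i P)).natDegree ≤ D := fun i =>
    (natDegree_restr_le _ _).trans ((totalDegree_pderiv_le i P).trans (by omega))
  have haD : a.natDegree ≤ D := hdeg 0
  have hbD : b.natDegree ≤ D := by
    rw [hb, natDegree_neg]
    exact natDegree_add_le_of_degree_le (hdeg 1) ((natDegree_C_mul_le _ _).trans haD)
  have hab : ∀ m ∈ L, (m.1 - ℓ.1) * a.eval (param ℓ m) = b.eval (param ℓ m) := by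
    intro m hm
    obtain ⟨hℓm, hs⟩ := hℓ m hm
    have h1 := congrArg (eval (param ℓ m)) (first_order (hPL m hm))
    have h2 := congrArg (eval (param ℓ m)) (first_order hPℓ)
    simp only [eval_add, eval_mul, eval_C, eval_zero, eval_restr_param hℓm hs] at h1 h2
    rw [← ha] at h1 h2
    simp only [hb, eval_neg, eval_add, eval_mul, eval_C]
    apply mul_left_cancel₀ (sub_ne_zero.2 hs.symm)
    linear_combination h1 - h2
  have hb0 : b ≠ 0 := by
    intro hb0
    have ha0 : a = 0 := by
      refine eq_zero_of_eval_param hℓ hL (fun m hm => ?_) (by omega)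
      have := hab m hm
      rw [hb0, eval_zero] at this
      exact (mul_eq_zero.1 this).resolve_left (sub_ne_zero.2 (hℓ m hm).2.symm)
    have h1 : restr ℓ (MvPolynomial.pderiv 1 P) = 0 := by
      rw [hb, ha0] at hb0
      simpa using hb0
    have h2 := first_order hPℓ
    rw [← ha, ha0, h1] at h2
    obtain ⟨i, hi⟩ := hgrad
    fin_cases i
    · exact hi ha0
    · exact hi h1
    · exact hi (by simpa using h2)
  have hda := natDegree_derivative_le a
  have hdb := natDegree_derivative_le b
  have hdda := natDegree_derivative_le (derivative a)
  have hddb := natDegree_derivative_le (derivative b)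
  have hW := eq_zero_of_eval_param hℓ hL
    (Q := (derivative (derivative a) * b - a * derivative (derivative b)) * b -
      2 * derivative b * (derivative a * b - a * derivative b))
    (fun m hm => eval_second_derivative_eq_zero (hℓ m hm).1 (hℓ m hm).2 hPℓ (hPL m hm)
      (hH m hm) ha hb) (by
      refine lt_of_le_of_lt ?_ hcard
      have h2 : (2 : K[X]).natDegree ≤ 0 := (natDegree_ofNat 2).le
      refine (natDegree_sub_le _ _).trans (max_le ?_ ?_)
      · refine (natDegree_mul_le_of_le (m := 2 * D) ((natDegree_sub_le _ _).trans
          (max_le ?_ ?_)) hbD).trans (by omega)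
        · exact (natDegree_mul_le_of_le (m := D) (by omega) hbD).trans (by omega)
        · exact (natDegree_mul_le_of_le (n := D) haD (by omega)).trans (by omega)
      · refine (natDegree_mul_le_of_le (m := D) (n := 2 * D) ((natDegree_mul_le_of_le (n := D)
          h2 (by omega)).trans (by omega)) ((natDegree_sub_le _ _).trans
          (max_le ?_ ?_))).trans (by omega)
        · exact (natDegree_mul_le_of_le (m := D) (by omega) hbD).trans (by omega)
        · exact (natDegree_mul_le_of_le (n := D) haD (by omega)).trans (by omega))
  obtain ⟨α, κ, hακ⟩ := exists_linear_of_second_derivative p hb0 haD hbD hD hW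
  have hlin : ∀ m ∈ L, b.eval (param ℓ m) ≠ 0 →
      α * m.1 + -κ * m.2.2 = 1 + α * ℓ.1 - κ * ℓ.2.2 := by
    intro m hm hbm
    have h1 := hab m hm
    rw [hακ] at h1
    simp only [eval_mul, eval_add, eval_C, eval_X] at h1
    have h2 : (m.1 - ℓ.1) * (α + κ * param ℓ m) = 1 := by
      apply mul_right_cancel₀ hbm
      linear_combination h1
    have h3 : param ℓ m * (ℓ.1 - m.1) = m.2.2 - ℓ.2.2 :=
      div_mul_cancel₀ _ (sub_ne_zero.2 (hℓ m hm).2)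
    linear_combination h2 + κ * h3
  have hfew : #{m ∈ L | b.eval (param ℓ m) = 0} ≤ D := by
    by_contra! hlt
    refine hb0 (eq_zero_of_eval_param (L := {m ∈ L | b.eval (param ℓ m) = 0})
      (fun m hm => hℓ m (mem_filter.1 hm).1)
      (fun m hm m' hm' => hL m (mem_filter.1 hm).1 m' (mem_filter.1 hm').1)
      (fun m hm => (mem_filter.1 hm).2) (by omega))
  have hsplit := card_filter_add_card_filter_not (s := L) (fun m => b.eval (param ℓ m) = 0)
  have hsub : #{m ∈ L | ¬ b.eval (param ℓ m) = 0} ≤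
      #{m ∈ L | α * m.1 + -κ * m.2.2 = 1 + α * ℓ.1 - κ * ℓ.2.2} := by
    refine card_le_card fun m hm => ?_
    obtain ⟨hm, hbm⟩ := mem_filter.1 hm
    exact mem_filter.2 ⟨hm, hlin m hm hbm⟩
  refine ⟨α, -κ, 1 + α * ℓ.1 - κ * ℓ.2.2, ?_, by omega⟩
  by_contra! h0
  have hκ : κ = 0 := neg_eq_zero.1 h0.2
  have ha0 : a = 0 := by rw [hακ, h0.1, hκ]; simp
  refine hb0 (eq_zero_of_eval_param hℓ hL (fun m hm => ?_) (by omega))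
  rw [← hab m hm, ha0, eval_zero, mul_zero]

/-- There is a nonzero polynomial of small degree that vanishes on few given lines. -/
theorem exists_vanishing {S : Finset (K × K × K)} {d : ℕ} (h : 3 * #S ≤ (d + 1) ^ 2) :
    ∃ P : MvPolynomial (Fin 3) K, P ≠ 0 ∧ P.totalDegree ≤ 3 * d ∧ ∀ ℓ ∈ S, restr ℓ P = 0 := by
  classical
  let e : (Fin 3 → Fin (d + 1)) → Fin 3 →₀ ℕ := fun i =>
    Finsupp.equivFunOnFinite.symm fun j => (i j : ℕ)
  have he : Function.Injective e := by
    intro i j hij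
    ext t
    exact DFunLike.congr_fun hij t
  let F : ((Fin 3 → Fin (d + 1)) → K) →ₗ[K] MvPolynomial (Fin 3) K :=
    ∑ i, MvPolynomial.monomial (e i) ∘ₗ LinearMap.proj i
  have hF : ∀ c, F c = ∑ i, MvPolynomial.monomial (e i) (c i) := by
    intro c; simp [F]
  have hdeg : ∀ c, (F c).totalDegree ≤ 3 * d := by
    intro c
    rw [hF]
    refine MvPolynomial.totalDegree_finsetSum_le fun i _ => ?_
    refine (MvPolynomial.totalDegree_monomial_le _ _).trans ?_
    rw [Finsupp.sum_fintype _ _ (fun _ => rfl)]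
    refine (Finset.sum_le_card_nsmul univ _ d fun j _ => ?_).trans (by simp)
    exact Nat.lt_succ_iff.1 (i j).2
  have hcoeff : ∀ c i, MvPolynomial.coeff (e i) (F c) = c i := by
    intro c i
    rw [hF, MvPolynomial.coeff_sum, Finset.sum_eq_single i]
    · simp
    · intro j _ hj
      rw [MvPolynomial.coeff_monomial, if_neg (fun h => hj (he h))]
    · simp
  let Φ : ((Fin 3 → Fin (d + 1)) → K) →ₗ[K] (S → Fin (3 * d + 1) → K) :=
    LinearMap.pi fun ℓ => LinearMap.pi fun j =>
      (Polynomial.lcoeff K (j : ℕ)) ∘ₗ (restr ℓ.1).toLinearMap ∘ₗ F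
  have hker : LinearMap.ker Φ ≠ ⊥ := by
    apply LinearMap.ker_ne_bot_of_finrank_lt
    rw [Module.finrank_fintype_fun_eq_card, Module.finrank_pi_fintype]
    simp only [Module.finrank_fintype_fun_eq_card, Fintype.card_fin, sum_const, smul_eq_mul,
      card_univ, Fintype.card_coe, Fintype.card_fun]
    nlinarith [Nat.mul_le_mul_right (3 * d + 1) h]
  obtain ⟨c, hc, hc0⟩ := (Submodule.ne_bot_iff _).1 hker
  refine ⟨F c, fun h0 => hc0 ?_, hdeg c, fun ℓ hℓ => ?_⟩
  · ext i
    rw [← hcoeff c i, h0]; simp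
  · ext j
    by_cases hj : j < 3 * d + 1
    · have := congrFun (congrFun (LinearMap.mem_ker.1 hc) ⟨ℓ, hℓ⟩) ⟨j, hj⟩
      simpa [Φ] using this
    · rw [coeff_zero, coeff_eq_zero_of_natDegree_lt]
      exact ((natDegree_restr_le _ _).trans (hdeg c)).trans_lt (by omega)

open scoped Classical in
theorem false_of_restr_pderiv_ne_zero (p : ℕ) [CharP K p] {S T : Finset (K × K × K)}
    {P : MvPolynomial (Fin 3) K} {D k δ : ℕ} {ℓ : K × K × K}
    (hST : ∀ ℓ ∈ S, ∀ m ∈ T, ℓ.1 ≠ m.1)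
    (hS : ∀ ℓ ∈ S, ∀ ℓ' ∈ S, Meets ℓ ℓ' → ℓ = ℓ') (hT : ∀ m ∈ T, ∀ m' ∈ T, Meets m m' → m = m')
    (hSδ : ∀ ℓ ∈ S, δ < #{m ∈ T | Meets ℓ m}) (hTδ : ∀ m ∈ T, δ < #{ℓ ∈ S | Meets ℓ m})
    (hk : ∀ A B c : K, (A ≠ 0 ∨ B ≠ 0) →
      #{m ∈ T | Meets ℓ m ∧ A * m.1 + B * m.2.2 = c} ≤ k)
    (hPS : ∀ ℓ ∈ S, restr ℓ P = 0) (hPT : ∀ m ∈ T, restr m P = 0)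
    (hPD : P.totalDegree ≤ D) (hD : 2 * D + 1 < p) (hδ : 5 * D + k ≤ δ)
    (hℓ : ℓ ∈ S) (hgrad : ∃ i, restr ℓ (MvPolynomial.pderiv i P) ≠ 0) : False := by
  have hH : ∀ m ∈ T, otherHessian m P = 0 := fun m hm =>
    otherHessian_eq_zero (L := {ℓ ∈ S | Meets ℓ m})
      (fun n hn => ⟨(mem_filter.1 hn).2.symm, (hST n (mem_filter.1 hn).1 m hm).symm⟩)
      (fun n hn n' hn' => hS n (mem_filter.1 hn).1 n' (mem_filter.1 hn').1) (hPT m hm)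
      (fun n hn => hPS n (mem_filter.1 hn).1) (by have := hTδ m hm; omega)
  have hL := hSδ ℓ hℓ
  obtain ⟨A, B, c, hAB, hle⟩ := exists_linear_relation p (ℓ := ℓ) (P := P) (D := D)
    (L := {m ∈ T | Meets ℓ m})
    (fun m hm => ⟨(mem_filter.1 hm).2, hST ℓ hℓ m (mem_filter.1 hm).1⟩)
    (fun n hn n' hn' => hT n (mem_filter.1 hn).1 n' (mem_filter.1 hn').1) (hPS ℓ hℓ)
    (fun n hn => hPT n (mem_filter.1 hn).1) (fun n hn => hH n (mem_filter.1 hn).1) hPD hD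
    (by omega) hgrad
  have := hk A B c hAB
  rw [filter_filter] at hle
  omega

open scoped Classical in
/-- Two families of pairwise disjoint null lines cannot be too rich in mutual intersections. -/
theorem false_of_rich (p : ℕ) [CharP K p] {S T : Finset (K × K × K)} {d k δ : ℕ}
    (hST : ∀ ℓ ∈ S, ∀ m ∈ T, ℓ.1 ≠ m.1)
    (hS : ∀ ℓ ∈ S, ∀ ℓ' ∈ S, Meets ℓ ℓ' → ℓ = ℓ') (hT : ∀ m ∈ T, ∀ m' ∈ T, Meets m m' → m = m')
    (hSδ : ∀ ℓ ∈ S, δ < #{m ∈ T | Meets ℓ m}) (hTδ : ∀ m ∈ T, δ < #{ℓ ∈ S | Meets ℓ m})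
    (hkT : ∀ ℓ ∈ S, ∀ A B c : K, (A ≠ 0 ∨ B ≠ 0) →
      #{m ∈ T | Meets ℓ m ∧ A * m.1 + B * m.2.2 = c} ≤ k)
    (hkS : ∀ m ∈ T, ∀ A B c : K, (A ≠ 0 ∨ B ≠ 0) →
      #{ℓ ∈ S | Meets ℓ m ∧ A * ℓ.1 + B * ℓ.2.2 = c} ≤ k)
    (hne : S.Nonempty ∨ T.Nonempty) (hd : 3 * #S ≤ (d + 1) ^ 2) (hp : 6 * d + 1 < p)
    (hδ : 15 * d + k ≤ δ) : False := by
  have hex : ∃ n, ∃ P : MvPolynomial (Fin 3) K, P.totalDegree = n ∧ P ≠ 0 ∧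
      P.totalDegree ≤ 3 * d ∧ (∀ ℓ ∈ S, restr ℓ P = 0) ∧ ∀ m ∈ T, restr m P = 0 := by
    obtain ⟨P, hP0, hPd, hPS⟩ := exists_vanishing hd
    refine ⟨_, P, rfl, hP0, hPd, hPS, fun m hm => ?_⟩
    refine eq_zero_of_eval_param (L := {ℓ ∈ S | Meets ℓ m})
      (fun n hn => ⟨(mem_filter.1 hn).2.symm, (hST n (mem_filter.1 hn).1 m hm).symm⟩)
      (fun n hn n' hn' => hS n (mem_filter.1 hn).1 n' (mem_filter.1 hn').1)
      (fun n hn => ?_) ?_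
    · rw [← eval_restr_param (mem_filter.1 hn).2.symm (hST n (mem_filter.1 hn).1 m hm).symm,
        hPS n (mem_filter.1 hn).1, eval_zero]
    · have := hTδ m hm
      have := natDegree_restr_le m P
      omega
  obtain ⟨P, hPn, hP0, hPd, hPS, hPT⟩ := Nat.find_spec hex
  have hmin : ∀ Q : MvPolynomial (Fin 3) K, Q ≠ 0 → Q.totalDegree < P.totalDegree →
      (∀ ℓ ∈ S, restr ℓ Q = 0) → ∃ m ∈ T, restr m Q ≠ 0 := by
    intro Q hQ0 hQ hQS
    by_contra! hQT
    exact Nat.find_min hex (hPn ▸ hQ) ⟨Q, rfl, hQ0, hQ.le.trans hPd, hQS, hQT⟩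
  have hdeg : P.totalDegree ≠ 0 := by
    intro h0
    rw [MvPolynomial.totalDegree_eq_zero_iff_eq_C] at h0
    have hr : ∀ ℓ : K × K × K, restr ℓ P ≠ 0 := by
      intro ℓ h
      rw [h0] at h
      apply hP0
      rw [h0]
      simpa [restr] using h
    rcases hne with ⟨ℓ, hℓ⟩ | ⟨m, hm⟩
    · exact hr ℓ (hPS ℓ hℓ)
    · exact hr m (hPT m hm)
  obtain ⟨i, hi⟩ := exists_pderiv_ne_zero p hdeg (by omega)
  have hlt : (MvPolynomial.pderiv i P).totalDegree < P.totalDegree :=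
    (totalDegree_pderiv_le i P).trans_lt (by omega)
  by_cases hgS : ∀ ℓ ∈ S, restr ℓ (MvPolynomial.pderiv i P) = 0
  · obtain ⟨m, hm, hgm⟩ := hmin _ hi hlt hgS
    have hsymm : ∀ ℓ m : K × K × K, Meets ℓ m ↔ Meets m ℓ := fun _ _ => ⟨.symm, .symm⟩
    refine false_of_restr_pderiv_ne_zero p (S := T) (T := S) (D := 3 * d) (k := k) (δ := δ)
      (fun n hn n' hn' => (hST n' hn' n hn).symm) hT hS ?_ ?_ ?_ hPT hPS hPd (by omega)
      (by omega) hm ⟨i, hgm⟩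
    · intro n hn
      simpa only [hsymm n] using hTδ n hn
    · intro n hn
      simpa only [hsymm n] using hSδ n hn
    · simpa only [hsymm m] using hkS m hm
  · push Not at hgS
    obtain ⟨ℓ, hℓ, hgℓ⟩ := hgS
    exact false_of_restr_pderiv_ne_zero p (D := 3 * d) hST hS hT hSδ hTδ (hkT ℓ hℓ) hPS hPT hPd
      (by omega) (by omega) hℓ ⟨i, hgℓ⟩

/-- A relation of large average degree contains a nonempty piece of large minimum degree. -/
theorem exists_subset_of_lt_sum {α β : Type*} [DecidableEq α] [DecidableEq β] (r : α → β → Prop)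
    [∀ a b, Decidable (r a b)] (δ : ℕ) (S : Finset α) (T : Finset β)
    (h : δ * (#S + #T) < ∑ a ∈ S, #{b ∈ T | r a b}) :
    ∃ S' ⊆ S, ∃ T' ⊆ T, (S'.Nonempty ∨ T'.Nonempty) ∧ (∀ a ∈ S', δ < #{b ∈ T' | r a b}) ∧
      ∀ b ∈ T', δ < #{a ∈ S' | r a b} := by
  induction hn : #S + #T using Nat.strong_induction_on generalizing S T with
  | _ n ih =>
  subst hn
  by_cases hS : ∀ a ∈ S, δ < #{b ∈ T | r a b}
  · by_cases hT : ∀ b ∈ T, δ < #{a ∈ S | r a b}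
    · refine ⟨S, Subset.rfl, T, Subset.rfl, ?_, hS, hT⟩
      rw [or_iff_not_imp_left, not_nonempty_iff_eq_empty]
      rintro rfl
      simp at h
    · push Not at hT
      obtain ⟨b, hb, hbδ⟩ := hT
      have hcard := card_erase_add_one hb
      obtain ⟨S', hS', T', hT', h'⟩ := ih (#S + #(T.erase b)) (by omega) S (T.erase b) (by
        have e1 := sum_card_bipartiteAbove_eq_sum_card_bipartiteBelow (s := S) (t := T) r
        have e2 := sum_card_bipartiteAbove_eq_sum_card_bipartiteBelow (s := S) (t := T.erase b) r
        simp only [bipartiteAbove, bipartiteBelow] at e1 e2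
        rw [e2]
        rw [e1, ← add_sum_erase T _ hb, ← hcard] at h
        linarith) rfl
      exact ⟨S', hS', T', hT'.trans (erase_subset _ _), h'⟩
  · push Not at hS
    obtain ⟨a, ha, haδ⟩ := hS
    have hcard := card_erase_add_one ha
    obtain ⟨S', hS', T', hT', h'⟩ := ih (#(S.erase a) + #T) (by omega) (S.erase a) T (by
      rw [← add_sum_erase S _ ha, ← hcard] at h
      linarith) rfl
    exact ⟨S', hS'.trans (erase_subset _ _), T', hT', h'⟩

open scoped Classical in
theorem sum_card_meets_le (p : ℕ) [CharP K p] {S T : Finset (K × K × K)} {d k : ℕ}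
    (hST : ∀ ℓ ∈ S, ∀ m ∈ T, ℓ.1 ≠ m.1)
    (hS : ∀ ℓ ∈ S, ∀ ℓ' ∈ S, Meets ℓ ℓ' → ℓ = ℓ') (hT : ∀ m ∈ T, ∀ m' ∈ T, Meets m m' → m = m')
    (hkT : ∀ ℓ ∈ S, ∀ A B c : K, (A ≠ 0 ∨ B ≠ 0) →
      #{m ∈ T | Meets ℓ m ∧ A * m.1 + B * m.2.2 = c} ≤ k)
    (hkS : ∀ m ∈ T, ∀ A B c : K, (A ≠ 0 ∨ B ≠ 0) →
      #{ℓ ∈ S | Meets ℓ m ∧ A * ℓ.1 + B * ℓ.2.2 = c} ≤ k)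
    (hd : 3 * #S ≤ (d + 1) ^ 2) (hp : 6 * d + 1 < p) :
    ∑ ℓ ∈ S, #{m ∈ T | Meets ℓ m} ≤ (15 * d + k) * (#S + #T) := by
  by_contra! hlt
  obtain ⟨S', hS', T', hT', hne, hSδ, hTδ⟩ := exists_subset_of_lt_sum Meets _ S T hlt
  refine false_of_rich p (d := d) (k := k) (fun ℓ hℓ m hm => hST ℓ (hS' hℓ) m (hT' hm))
    (fun ℓ hℓ ℓ' hℓ' => hS ℓ (hS' hℓ) ℓ' (hS' hℓ')) (fun m hm m' hm' => hT m (hT' hm) m' (hT' hm'))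
    hSδ hTδ (fun ℓ hℓ A B c h => ?_) (fun m hm A B c h => ?_) hne
    ((Nat.mul_le_mul_left 3 (card_le_card hS')).trans hd) hp le_rfl
  · exact (card_le_card (filter_subset_filter _ hT')).trans (hkT ℓ (hS' hℓ) A B c h)
  · exact (card_le_card (filter_subset_filter _ hS')).trans (hkS m (hT' hm) A B c h)

section Embedding

variable {F : Type*} [Field F]

theorem coeff_eq_zero_of_cubic {a b c d : F}
    (h : RatFunc.C a + RatFunc.C b * RatFunc.X + RatFunc.C c * RatFunc.X ^ 2 +
      RatFunc.C d * RatFunc.X ^ 3 = 0) : a = 0 ∧ b = 0 ∧ c = 0 ∧ d = 0 := by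
  have h' : C a + C b * X + C c * X ^ 2 + C d * X ^ 3 = (0 : F[X]) := by
    apply RatFunc.algebraMap_injective F
    simpa using h
  refine ⟨?_, ?_, ?_, ?_⟩
  · simpa [coeff_X, coeff_C] using congrArg (coeff · 0) h'
  · simpa [coeff_X, coeff_C] using congrArg (coeff · 1) h'
  · simpa [coeff_X, coeff_C] using congrArg (coeff · 2) h'
  · simpa [coeff_X, coeff_C] using congrArg (coeff · 3) h'

/-- The null line over `F(λ)` attached to a triple `(x, c, a)`. -/
noncomputable def leftLine (q : F × F × F) : RatFunc F × RatFunc F × RatFunc F :=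
  (RatFunc.X ^ 3 * RatFunc.C q.2.1,
    RatFunc.X ^ 3 * RatFunc.C q.2.1 * RatFunc.C q.2.2 + RatFunc.C q.1 +
      RatFunc.X * RatFunc.C q.2.1 + RatFunc.X ^ 2 * RatFunc.C q.2.2,
    RatFunc.C q.2.2)

/-- The null line over `F(λ)` attached to a triple `(b, y, a)`. -/
noncomputable def rightLine (r : F × F × F) : RatFunc F × RatFunc F × RatFunc F :=
  (RatFunc.X ^ 2 + RatFunc.C r.1,
    -(RatFunc.X ^ 2 + RatFunc.C r.1) * (RatFunc.C (r.2.1 * r.1) + RatFunc.X) / RatFunc.X ^ 3 -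
      RatFunc.C (r.2.2 * r.1),
    -(RatFunc.C (r.2.1 * r.1) + RatFunc.X) / RatFunc.X ^ 3)

theorem meets_leftLine_rightLine (q r : F × F × F) :
    Meets (leftLine q) (rightLine r) ↔
      q.1 - q.2.1 * r.2.1 * r.1 - q.2.2 * r.1 + r.2.2 * r.1 = 0 := by
  have hX : (RatFunc.X : RatFunc F) ≠ 0 := RatFunc.X_ne_zero
  rw [← map_eq_zero (RatFunc.C : F →+* RatFunc F)]
  simp only [Meets, leftLine, rightLine, map_add, map_sub, map_mul]
  field_simp
  constructor
  · intro h
    apply mul_left_cancel₀ (pow_ne_zero 3 hX)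
    linear_combination h
  · intro h
    linear_combination RatFunc.X ^ 3 * h

theorem eq_of_meets_leftLine {q q' : F × F × F} (h : Meets (leftLine q) (leftLine q')) :
    q = q' := by
  obtain ⟨x, c, a⟩ := q
  obtain ⟨x', c', a'⟩ := q'
  simp only [Meets, leftLine] at h
  obtain ⟨h1, h2, h3, -⟩ := coeff_eq_zero_of_cubic (a := x - x') (b := c - c') (c := a - a')
    (d := c * a' - c' * a) (by
      simp only [map_sub, map_mul]
      linear_combination h)
  rw [sub_eq_zero.1 h1, sub_eq_zero.1 h2, sub_eq_zero.1 h3]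

theorem eq_of_meets_rightLine {r r' : F × F × F} (hr : r.1 ≠ 0)
    (h : Meets (rightLine r) (rightLine r')) : r = r' := by
  have hX : (RatFunc.X : RatFunc F) ≠ 0 := RatFunc.X_ne_zero
  obtain ⟨b, y, a⟩ := r
  obtain ⟨b', y', a'⟩ := r'
  simp only [Meets, rightLine, map_mul] at h
  field_simp at h
  obtain ⟨-, h1, h2, h3⟩ := coeff_eq_zero_of_cubic (a := b' * y * b - b * y' * b') (b := b' - b)
    (c := y * b - y' * b') (d := a' * b' - a * b) (by
      simp only [map_sub, map_mul]
      linear_combination h)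
  obtain rfl := sub_eq_zero.1 h1
  rw [mul_right_cancel₀ hr (sub_eq_zero.1 h2), mul_right_cancel₀ hr (sub_eq_zero.1 h3)]

theorem leftLine_fst_ne_rightLine_fst (q r : F × F × F) :
    (leftLine q).1 ≠ (rightLine r).1 := by
  intro h
  simp only [leftLine, rightLine] at h
  have := (coeff_eq_zero_of_cubic (a := -r.1) (b := 0) (c := -1) (d := q.2.1) (by
    simp only [map_neg, map_zero, map_one]
    linear_combination h)).2.2.1
  simp at this

theorem leftLine_injective : Function.Injective (leftLine (F := F)) := by
  intro q q' h
  apply eq_of_meets_leftLine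
  rw [h]
  simp [Meets]

theorem rightLine_injOn : Set.InjOn (rightLine (F := F)) {r | r.1 ≠ 0} := by
  intro r hr r' _ h
  apply eq_of_meets_rightLine hr
  rw [h]
  simp [Meets]

end Embedding

open scoped Classical in
theorem card_filter_leftLine_le {F : Type*} [Field F] {X C A : Finset F} {k : ℕ} (hC : #C ≤ k)
    (hA : #A ≤ k) (r : F × F × F) {α β : RatFunc F} (γ : RatFunc F) (h : α ≠ 0 ∨ β ≠ 0) :
    #{ℓ ∈ (X ×ˢ C ×ˢ A).image leftLine | Meets ℓ (rightLine r) ∧ α * ℓ.1 + β * ℓ.2.2 = γ} ≤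
      k := by
  have hX : (RatFunc.X : RatFunc F) ≠ 0 := RatFunc.X_ne_zero
  rw [filter_image]
  refine card_image_le.trans ?_
  simp only [meets_leftLine_rightLine]
  by_cases hβ : β = 0
  · refine (card_le_card_of_injOn (t := A) (fun q => q.2.2) ?_ ?_).trans hA
    · intro q hq
      simp only [mem_coe, mem_filter, mem_product] at hq
      exact hq.1.2.2
    · intro q hq q' hq' hqq
      rw [mem_coe, mem_filter, mem_product, mem_product] at hq hq'
      simp only [leftLine, hβ] at hq hq'
      obtain ⟨x, c, a⟩ := q
      obtain ⟨x', c', a'⟩ := q'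
      obtain rfl : a = a' := hqq
      have hα : α ≠ 0 := by tauto
      have hc : c = c' := by
        apply RatFunc.C_injective
        apply mul_left_cancel₀ (mul_ne_zero hα (pow_ne_zero 3 hX))
        linear_combination hq.2.2 - hq'.2.2
      subst hc
      have : x = x' := by linear_combination hq.2.1 - hq'.2.1
      rw [this]
  · refine (card_le_card_of_injOn (t := C) (fun q => q.2.1) ?_ ?_).trans hC
    · intro q hq
      simp only [mem_coe, mem_filter, mem_product] at hq
      exact hq.1.2.1
    · intro q hq q' hq' hqq
      rw [mem_coe, mem_filter, mem_product, mem_product] at hq hq'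
      simp only [leftLine] at hq hq'
      obtain ⟨x, c, a⟩ := q
      obtain ⟨x', c', a'⟩ := q'
      obtain rfl : c = c' := hqq
      have ha : a = a' := by
        apply RatFunc.C_injective
        apply mul_left_cancel₀ hβ
        linear_combination hq.2.2 - hq'.2.2
      subst ha
      have : x = x' := by linear_combination hq.2.1 - hq'.2.1
      rw [this]

open scoped Classical in
theorem card_filter_rightLine_le {F : Type*} [Field F] {B Y A : Finset F} {k : ℕ} (h0 : 0 ∉ B)
    (hB : #B ≤ k) (hY : #Y ≤ k) (q : F × F × F) {α β : RatFunc F} (γ : RatFunc F)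
    (h : α ≠ 0 ∨ β ≠ 0) :
    #{m ∈ (B ×ˢ Y ×ˢ A).image rightLine | Meets (leftLine q) m ∧ α * m.1 + β * m.2.2 = γ} ≤
      k := by
  have hX : (RatFunc.X : RatFunc F) ≠ 0 := RatFunc.X_ne_zero
  rw [filter_image]
  refine card_image_le.trans ?_
  simp only [meets_leftLine_rightLine]
  by_cases hβ : β = 0
  · refine (card_le_card_of_injOn (t := Y) (fun r => r.2.1) ?_ ?_).trans hY
    · intro r hr
      simp only [mem_coe, mem_filter, mem_product] at hr
      exact hr.1.2.1
    · intro r hr r' hr' hrr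
      rw [mem_coe, mem_filter, mem_product, mem_product] at hr hr'
      simp only [rightLine, hβ] at hr hr'
      obtain ⟨b, y, a⟩ := r
      obtain ⟨b', y', a'⟩ := r'
      obtain rfl : y = y' := hrr
      have hα : α ≠ 0 := by tauto
      have hb : b = b' := by
        apply RatFunc.C_injective
        apply mul_left_cancel₀ hα
        linear_combination hr.2.2 - hr'.2.2
      subst hb
      have hb0 : b ≠ 0 := ne_of_mem_of_not_mem hr.1.1 h0
      have : a = a' := by
        apply mul_right_cancel₀ hb0
        linear_combination hr.2.1 - hr'.2.1
      rw [this]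
  · refine (card_le_card_of_injOn (t := B) (fun r => r.1) ?_ ?_).trans hB
    · intro r hr
      simp only [mem_coe, mem_filter, mem_product] at hr
      exact hr.1.1
    · intro r hr r' hr' hrr
      rw [mem_coe, mem_filter, mem_product, mem_product] at hr hr'
      simp only [rightLine] at hr hr'
      obtain ⟨b, y, a⟩ := r
      obtain ⟨b', y', a'⟩ := r'
      obtain rfl : b = b' := hrr
      have hb0 : b ≠ 0 := ne_of_mem_of_not_mem hr.1.1 h0
      have hy : y = y' := by
        apply mul_right_cancel₀ hb0
        apply RatFunc.C_injective
        apply mul_left_cancel₀ hβ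
        have h1 := hr.2.2
        have h2 := hr'.2.2
        field_simp at h1 h2
        simp only [map_mul] at h1 h2 ⊢
        linear_combination -h1 + h2
      subst hy
      have : a = a' := by
        apply mul_right_cancel₀ hb0
        linear_combination hr.2.1 - hr'.2.1
      rw [this]

theorem card_solutions_le (p : ℕ) [Fact p.Prime] {X C A B Y : Finset (ZMod p)} {d k : ℕ}
    (h0 : 0 ∉ B) (hC : #C ≤ k) (hA : #A ≤ k) (hB : #B ≤ k) (hY : #Y ≤ k)
    (hd : 3 * (#X * (#C * #A)) ≤ (d + 1) ^ 2) (hp : 6 * d + 1 < p) :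
    #{z ∈ (X ×ˢ C ×ˢ A) ×ˢ (B ×ˢ Y ×ˢ A) |
      z.1.1 - z.1.2.1 * z.2.2.1 * z.2.1 - z.1.2.2 * z.2.1 + z.2.2.2 * z.2.1 = 0} ≤
      (15 * d + k) * (#X * (#C * #A) + #B * (#Y * #A)) := by
  classical
  have hB0 : ∀ r ∈ B ×ˢ Y ×ˢ A, r.1 ≠ 0 := fun r hr =>
    ne_of_mem_of_not_mem (mem_product.1 hr).1 h0
  have hinj : Set.InjOn (rightLine (F := ZMod p)) (B ×ˢ Y ×ˢ A : Finset _) :=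
    rightLine_injOn.mono fun r hr => hB0 r hr
  have hcS : #((X ×ˢ C ×ˢ A).image leftLine) = #X * (#C * #A) := by
    rw [card_image_of_injective _ leftLine_injective, card_product, card_product]
  have hcT : #((B ×ˢ Y ×ˢ A).image rightLine) = #B * (#Y * #A) := by
    rw [card_image_of_injOn hinj, card_product, card_product]
  have : CharP (RatFunc (ZMod p)) p := charP_of_injective_algebraMap
    (FaithfulSMul.algebraMap_injective (ZMod p) (RatFunc (ZMod p))) p
  have key := sum_card_meets_le p (K := RatFunc (ZMod p)) (d := d) (k := k)
    (S := (X ×ˢ C ×ˢ A).image leftLine) (T := (B ×ˢ Y ×ˢ A).image rightLine)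
    (by
      simp only [forall_mem_image]
      exact fun q _ r _ => leftLine_fst_ne_rightLine_fst q r)
    (by
      simp only [forall_mem_image]
      exact fun q _ q' _ h => congrArg _ (eq_of_meets_leftLine h))
    (by
      simp only [forall_mem_image]
      exact fun r hr r' _ h => congrArg _ (eq_of_meets_rightLine (hB0 r hr) h))
    (by
      simp only [forall_mem_image]
      exact fun q _ α β γ h => card_filter_rightLine_le h0 hB hY q γ h)
    (by
      simp only [forall_mem_image]
      exact fun r _ α β γ h => card_filter_leftLine_le hC hA r γ h)
    (by rwa [hcS]) hp
  rw [hcS, hcT] at key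
  refine le_trans (le_of_eq ?_) key
  rw [sum_image leftLine_injective.injOn, card_filter, sum_product]
  refine sum_congr rfl fun q _ => ?_
  rw [filter_image, card_image_of_injOn (hinj.mono (filter_subset _ _)), card_filter]
  simp only [meets_leftLine_rightLine]

theorem sq_card_mul_addE_le (p : ℕ) [Fact p.Prime] {A B : Finset (ZMod p)} {d : ℕ} (hBA : B ⊆ A)
    (h0 : 0 ∉ B) (hB : B.Nonempty) (hd : 3 * (#(A * A) * #B * #A) ≤ (d + 1) ^ 2)
    (hp : 6 * d + 1 < p) :
    #B ^ 2 * addE A ≤ (15 * d + #(A * A)) * (2 * (#(A * A) * #B * #A)) := by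
  classical
  obtain ⟨b, hb⟩ := hB
  have hAA : #A ≤ #(A * A) := by
    refine card_le_card_of_injOn (fun a => a * b) (fun a ha => mul_mem_mul ha (hBA hb)) ?_
    exact fun a _ a' _ h => mul_right_cancel₀ (ne_of_mem_of_not_mem hb h0) h
  have hBc := card_le_card hBA
  have hinv : #(B.image (·⁻¹)) = #B := card_image_of_injective _ inv_injective
  have key := card_solutions_le p (X := A * A) (C := B.image (·⁻¹)) (A := A) (B := B) (Y := A * A)
    (d := d) (k := #(A * A)) h0 (by omega) hAA (by omega) le_rfl
    (by rw [hinv]; linarith) hp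
  rw [hinv] at key
  refine le_trans ?_ (key.trans (le_of_eq (by ring)))
  rw [addE, sq, ← card_product, ← card_product]
  refine card_le_card_of_injOn (fun z => ((z.2.1 * z.1.1, z.1.2⁻¹, z.2.2.2.1),
    (z.1.1, z.2.2.2.2 * z.1.2, z.2.2.1))) ?_ ?_
  · rintro ⟨⟨β, γ⟩, a₁, a₂, a₃, a₄⟩ hz
    simp only [mem_coe, mem_filter, mem_product] at hz
    obtain ⟨⟨hβ, hγ⟩, ⟨h1, h2, h3, h4⟩, hz⟩ := hz
    have hγ0 : γ ≠ 0 := ne_of_mem_of_not_mem hγ h0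
    simp only [mem_coe, mem_filter, mem_product]
    refine ⟨⟨⟨mul_mem_mul h1 (hBA hβ), mem_image_of_mem _ hγ, h3⟩, hβ,
      mul_mem_mul h4 (hBA hγ), h2⟩, ?_⟩
    have : γ⁻¹ * (a₄ * γ) = a₄ := by field_simp
    rw [this]
    linear_combination β * hz
  · rintro ⟨⟨β, γ⟩, a₁, a₂, a₃, a₄⟩ hz ⟨⟨β', γ'⟩, a₁', a₂', a₃', a₄'⟩ hz' h
    simp only [mem_coe, mem_filter, mem_product] at hz hz'
    simp only [Prod.mk.injEq, inv_inj] at h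
    obtain ⟨⟨e1, rfl, rfl⟩, rfl, e2, rfl⟩ := h
    rw [mul_right_cancel₀ (ne_of_mem_of_not_mem hz.1.1 h0) e1,
      mul_right_cancel₀ (ne_of_mem_of_not_mem hz.1.2 h0) e2]

theorem addE_le_card_pow_three {p : ℕ} (A : Finset (ZMod p)) : addE A ≤ #A ^ 3 := by
  have h : #(A ×ˢ A ×ˢ A) = #A ^ 3 := by simp only [card_product]; ring
  rw [addE, ← h]
  refine card_le_card_of_injOn (fun x => (x.1, x.2.1, x.2.2.1)) ?_ ?_
  · rintro ⟨a, b, c, d⟩ hx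
    simp only [mem_coe, mem_filter, mem_product] at hx ⊢
    exact ⟨hx.1.1, hx.1.2.1, hx.1.2.2.1⟩
  · rintro ⟨a, b, c, d⟩ hx ⟨a', b', c', d'⟩ hx' h
    simp only [mem_coe, mem_filter, mem_product] at hx hx'
    simp only [Prod.mk.injEq] at h
    obtain ⟨rfl, rfl, rfl⟩ := h
    rw [add_left_cancel (hx.2.symm.trans hx'.2)]

theorem card_mul_addE_le (p : ℕ) [Fact p.Prime] {A : Finset (ZMod p)} {m : ℕ} (hm0 : 0 < m)
    (hm : m ≤ #(A.erase 0)) (hp : 192 * (#(A * A) * m * #A) < p ^ 2) :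
    ∃ d, d ^ 2 ≤ 3 * (#(A * A) * m * #A) ∧
      m * addE A ≤ (15 * d + #(A * A)) * (2 * (#(A * A) * #A)) := by
  obtain ⟨B, hBA, rfl⟩ := exists_subset_card_eq hm
  have hBA' := hBA.trans (erase_subset _ _)
  have hA : A.Nonempty := (card_pos.1 hm0).mono hBA'
  have hpos : 0 < #(A * A) * #B * #A :=
    Nat.mul_pos (Nat.mul_pos (card_pos.2 (hA.mul hA)) hm0) (card_pos.2 hA)
  set N := #(A * A) * #B * #A with hN
  have hd1 := Nat.sqrt_le' (3 * N)
  have hd2 := Nat.lt_succ_sqrt' (3 * N)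
  set d := Nat.sqrt (3 * N)
  have hd0 : 0 < d := Nat.sqrt_pos.2 (by omega)
  have hdp : 8 * d < p := lt_of_pow_lt_pow_left₀ 2 (Nat.zero_le _) (by nlinarith)
  refine ⟨d, hd1, ?_⟩
  have key := sq_card_mul_addE_le p (d := d) hBA' (fun h => notMem_erase 0 A (hBA h))
    (card_pos.1 hm0) hd2.le (by omega)
  apply Nat.le_of_mul_le_mul_left _ hm0
  nlinarith

/-- The energy bound for small sets. -/
theorem addE_le_of_lt (p : ℕ) [Fact p.Prime] {A : Finset (ZMod p)} (hA : 0 < #(A.erase 0))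
    (hp : 192 * (#(A * A) * #(A.erase 0) * #A) < p ^ 2) :
    (addE A : ℝ) ≤ 124 * ((#(A * A) : ℝ) ^ ((3 : ℝ) / 2) * #A) := by
  obtain ⟨d, hd, hE⟩ := card_mul_addE_le p hA le_rfl hp
  have h0 : #A ≤ 2 * #(A.erase 0) := by
    have := pred_card_le_card_erase (s := A) (a := 0)
    omega
  have h1 : #(A.erase 0) ≤ #A := card_le_card (erase_subset _ _)
  have h2 : #(A * A) ≤ #A * #A := card_mul_le
  generalize #(A.erase 0) = m at *
  generalize addE A = E at *
  generalize #A = n at *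
  generalize #(A * A) = h at *
  have hn : 0 < n := hA.trans_le h1
  have hE' : E ≤ 60 * (d * h) + 4 * h ^ 2 := by
    apply Nat.le_of_mul_le_mul_left _ hn
    nlinarith
  have hd' : d ^ 2 ≤ 3 * h * n ^ 2 := by nlinarith [Nat.mul_le_mul_left (3 * (h * n)) h1]
  have hpow : (h : ℝ) ^ ((3 : ℝ) / 2) = h * √h := by
    rw [Real.sqrt_eq_rpow, show (3 : ℝ) / 2 = 1 + 1 / 2 by norm_num,
      Real.rpow_add_of_nonneg (by positivity) (by norm_num) (by norm_num), Real.rpow_one]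
  rw [hpow]
  have hs := Real.sq_sqrt (Nat.cast_nonneg (α := ℝ) h)
  have hs0 := Real.sqrt_nonneg (h : ℝ)
  set s := √(h : ℝ)
  have hdR : (d : ℝ) ≤ 2 * s * n := by
    apply le_of_sq_le_sq _ (by positivity)
    have : (d : ℝ) ^ 2 ≤ 3 * h * n ^ 2 := by exact_mod_cast hd'
    nlinarith [sq_nonneg (s * n)]
  have hsn : s ≤ n := by
    apply le_of_sq_le_sq _ (by positivity)
    have : (h : ℝ) ≤ n * n := by exact_mod_cast h2
    nlinarith
  have hER : (E : ℝ) ≤ 60 * (d * h) + 4 * h ^ 2 := by exact_mod_cast hE'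
  have h3 : (d : ℝ) * h ≤ 2 * s * n * h := by gcongr
  have h4 : (h : ℝ) ^ 2 ≤ h * s * n := by
    have : (h : ℝ) * s * s ≤ h * s * n := by gcongr
    nlinarith
  linarith

/-- The energy bound for large sets. -/
theorem addE_le_of_le (p : ℕ) [Fact p.Prime] {A : Finset (ZMod p)} (hA : 0 < #A)
    (hAA : #A ≤ #(A * A)) (hp : p ^ 2 ≤ 192 * (#(A * A) * #(A.erase 0) * #A)) :
    (addE A : ℝ) ≤ 2300 * ((#(A * A) : ℝ) ^ 2 * (#A : ℝ) ^ 2 / p) := by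
  have hp0 : 0 < p := (Fact.out : p.Prime).pos
  have hhp : #(A * A) ≤ p := by simpa [ZMod.card] using card_le_univ (A * A)
  suffices h : addE A * p ≤ 2300 * (#(A * A) ^ 2 * #A ^ 2) by
    rw [← mul_div_assoc, le_div_iff₀ (by exact_mod_cast hp0)]
    exact_mod_cast h
  by_cases hlarge : p ^ 2 ≤ 192 * (#(A * A) * #A)
  · have hE := addE_le_card_pow_three A
    have hph : p ≤ 14 * #(A * A) := by
      apply (Nat.pow_le_pow_iff_left two_ne_zero).1
      nlinarith [Nat.mul_le_mul_left #(A * A) hAA]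
    calc addE A * p ≤ #A ^ 3 * (14 * #(A * A)) := Nat.mul_le_mul hE hph
      _ = 14 * (#A * #(A * A) * #A ^ 2) := by ring
      _ ≤ 2300 * (#(A * A) * #(A * A) * #A ^ 2) := by gcongr; norm_num
      _ = 2300 * (#(A * A) ^ 2 * #A ^ 2) := by ring
  · push Not at hlarge
    set q := 192 * (#(A * A) * #A) with hq
    have hq0 : 0 < q := Nat.mul_pos (by norm_num) (Nat.mul_pos (by omega) hA)
    have hdiv := Nat.div_add_mod (p ^ 2 - 1) q
    have hmod := Nat.mod_lt (p ^ 2 - 1) hq0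
    have hm0 : 0 < (p ^ 2 - 1) / q := Nat.div_pos (by omega) hq0
    set m := (p ^ 2 - 1) / q
    have hm1 : q * m < p ^ 2 := by omega
    have hm2 : p ^ 2 ≤ q * m + q := by omega
    have hm : m ≤ #(A.erase 0) := by
      apply Nat.le_of_mul_le_mul_left _ hq0
      refine hm1.le.trans (hp.trans (le_of_eq ?_))
      rw [hq]; ring
    obtain ⟨d, hd, hE⟩ := card_mul_addE_le p hm0 hm (lt_of_eq_of_lt (by rw [hq]; ring) hm1)
    have hdp : 8 * d ≤ p := by
      apply (Nat.pow_le_pow_iff_left two_ne_zero).1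
      nlinarith
    have hm3 : p ^ 2 ≤ 2 * (q * m) := by nlinarith
    generalize addE A = E at *
    generalize #(A * A) = h at *
    generalize #A = n at *
    have h1 : 8 * (m * E) ≤ 23 * p * (2 * (h * n)) := by nlinarith [Nat.zero_le (h * n)]
    have h2 : p ^ 2 * E ≤ 2 * q * (m * E) := by nlinarith
    apply Nat.le_of_mul_le_mul_left _ hp0
    have h3 : 8 * (2 * q * (m * E)) ≤ 2 * q * (23 * p * (2 * (h * n))) := by nlinarith
    have h4 : 2 * q * (23 * p * (2 * (h * n))) = 8 * (2208 * (p * (h ^ 2 * n ^ 2))) := by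
      rw [hq]; ring
    nlinarith [Nat.zero_le (p * (h ^ 2 * n ^ 2))]

end NullLine

/-- Lemma 4.6: `E₊(A) ≪ |A·A|^(3/2)·|A| + |A·A|²·|A|²/p` for `A ⊆ 𝔽_p`. -/
theorem addE_le_mul_set :
    ∃ K : ℝ, 0 < K ∧ ∀ p : ℕ, p.Prime → ∀ A : Finset (ZMod p),
      (addE A : ℝ) ≤
        K * (((A * A).card : ℝ) ^ ((3 : ℝ) / 2) * (A.card : ℝ) +
          ((A * A).card : ℝ) ^ 2 * (A.card : ℝ) ^ 2 / (p : ℝ)) := by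
  refine ⟨2300, by norm_num, fun p hp A => ?_⟩
  have : Fact p.Prime := ⟨hp⟩
  have hnn₁ : 0 ≤ ((#(A * A) : ℝ) ^ ((3 : ℝ) / 2) * #A) := by positivity
  have hnn₂ : 0 ≤ (#(A * A) : ℝ) ^ 2 * (#A : ℝ) ^ 2 / p := by positivity
  rcases Nat.eq_zero_or_pos #(A.erase 0) with h0 | h0
  · have hE := NullLine.addE_le_card_pow_three A
    have h1 := pred_card_le_card_erase (s := A) (a := 0)
    rcases A.eq_empty_or_nonempty with rfl | hA
    · have h2 : addE (∅ : Finset (ZMod p)) = 0 := by simpa using hE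
      rw [h2, Nat.cast_zero]
      positivity
    · have hc : #A = 1 := by
        have := hA.card_pos
        omega
      have h3 : (1 : ℝ) ≤ #(A * A) := by exact_mod_cast (hA.mul hA).card_pos
      have h4 := Real.one_le_rpow h3 (show (0 : ℝ) ≤ 3 / 2 by norm_num)
      have h5 : (addE A : ℝ) ≤ 1 := by
        rw [hc] at hE
        exact_mod_cast hE
      rw [hc] at hnn₁ hnn₂ ⊢
      rw [Nat.cast_one, mul_one] at hnn₁ ⊢
      rw [Nat.cast_one] at hnn₂
      linarith
  · obtain ⟨b, hb⟩ := card_pos.1 h0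
    have hAA : #A ≤ #(A * A) :=
      card_le_card_of_injOn (fun a => a * b)
        (fun a ha => mul_mem_mul ha (mem_of_mem_erase hb))
        fun a _ a' _ h => mul_right_cancel₀ (ne_of_mem_erase hb) h
    rcases lt_or_ge (192 * (#(A * A) * #(A.erase 0) * #A)) (p ^ 2) with h | h
    · have := NullLine.addE_le_of_lt p h0 h
      linarith
    · have := NullLine.addE_le_of_le p (card_pos.2 ⟨b, mem_of_mem_erase hb⟩) hAA h
      linarith
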